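/- Let n ≥ 2 be an integer. Then every residue class z modulo n can be written as z ≡ x^2 + y^2 (mod n) for some integers x and y (where x^2 ≡ 0 or y^2 ≡ 0 (mod n) is allowed) if and only if both of the following hold: (1) n is not divisible by q^2 for any prime q with q ≡ 3 (mod 4); and (2) n is not divisible by 4. -/

import Mathlib

/-- A prime `p ≡ 3 (mod 4)` dividing a sum of two squares divides its first term. -/
theorem dvd_of_dvd_sq_add_sq {p : ℕ} (hp : p.Prime) (h3 : p % 4 = 3) {x y : ℤ}
    (h : (p : ℤ) ∣ x ^ 2 + y ^ 2) : (p : ℤ) ∣ x := by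
  have := Fact.mk hp
  rw [← ZMod.intCast_zmod_eq_zero_iff_dvd] at h ⊢
  push_cast at h
  by_contra hx
  exact ZMod.mod_four_ne_three_of_sq_eq_neg_sq' hx (eq_neg_of_add_eq_zero_right h) h3

/-- Modulo every positive power of a prime `p ≡ 1 (mod 4)`, `-1` is a square. -/
theorem exists_pow_dvd_sq_add_one {p : ℕ} (hp : p.Prime) (h1 : p % 4 = 1) (k : ℕ) :
    ∃ i : ℤ, (p : ℤ) ^ (k + 1) ∣ i ^ 2 + 1 := by
  have := Fact.mk hp
  induction k with
  | zero =>
    obtain ⟨y, hy⟩ := ZMod.exists_sq_eq_neg_one_iff.2 (show p % 4 ≠ 3 by omega)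
    obtain ⟨i, rfl⟩ := ZMod.intCast_surjective y
    refine ⟨i, ?_⟩
    rw [zero_add, pow_one, ← ZMod.intCast_zmod_eq_zero_iff_dvd]
    push_cast
    rw [sq, ← hy, neg_add_cancel]
  | succ k ih =>
    obtain ⟨i, m, hm⟩ := ih
    obtain ⟨s, hs⟩ : ∃ s : ℤ, (p : ℤ) + 1 = 2 * s := ⟨((p : ℤ) + 1) / 2, by omega⟩
    refine ⟨i + p ^ (k + 1) * (m * i * s),
      p ^ k * m ^ 2 * (2 * s) - m + p ^ k * (m * i * s) ^ 2, ?_⟩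
    linear_combination (1 + 2 * (p : ℤ) ^ (k + 1) * m * s) * hm +
      (p : ℤ) ^ (k + 1) * m * hs

/-- If `-1` is a square modulo an odd `n`, every integer is a sum of two squares modulo `n`. -/
theorem exists_sq_add_sq_modEq_of_dvd_sq_add_one {n i : ℤ} (hn : n % 2 = 1)
    (hi : n ∣ i ^ 2 + 1) (z : ℤ) : ∃ x y : ℤ, x ^ 2 + y ^ 2 ≡ z [ZMOD n] := by
  obtain ⟨m, hm⟩ := hi
  obtain ⟨s, hs⟩ : ∃ s : ℤ, n + 1 = 2 * s := ⟨(n + 1) / 2, by omega⟩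
  refine ⟨s * (z + 1), i * s * (z - 1), (Int.modEq_iff_dvd.2 ?_).symm⟩
  refine ⟨(n + 2) * z + s ^ 2 * (z - 1) ^ 2 * m, ?_⟩
  linear_combination s ^ 2 * (z - 1) ^ 2 * hm - z * (n + 1 + 2 * s) * hs

/-- Representability of all residues as sums of two squares is multiplicative. -/
theorem exists_sq_add_sq_modEq_mul {a b : ℕ} (hab : a.Coprime b) {z : ℤ}
    (ha : ∃ x y : ℤ, x ^ 2 + y ^ 2 ≡ z [ZMOD a]) (hb : ∃ x y : ℤ, x ^ 2 + y ^ 2 ≡ z [ZMOD b]) :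
    ∃ x y : ℤ, x ^ 2 + y ^ 2 ≡ z [ZMOD (a * b : ℕ)] := by
  obtain ⟨x, y, h⟩ := ha
  obtain ⟨u, v, h'⟩ := hb
  have crt (c d : ℤ) : ∃ e : ℤ, e ≡ c [ZMOD a] ∧ e ≡ d [ZMOD b] := by
    obtain ⟨r, s, hrs⟩ := Nat.isCoprime_iff_coprime.2 hab
    refine ⟨c * (s * b) + d * (r * a), (Int.modEq_iff_dvd.2 ⟨r * (c - d), ?_⟩),
      (Int.modEq_iff_dvd.2 ⟨s * (d - c), ?_⟩)⟩
    · linear_combination (-c) * hrs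
    · linear_combination (-d) * hrs
  obtain ⟨X, hX, hX'⟩ := crt x u
  obtain ⟨Y, hY, hY'⟩ := crt y v
  refine ⟨X, Y, ?_⟩
  push_cast
  rw [← Int.modEq_and_modEq_iff_modEq_mul (by simpa using hab)]
  exact ⟨((hX.pow 2).add (hY.pow 2)).trans h, ((hX'.pow 2).add (hY'.pow 2)).trans h'⟩

/-- Characterization of the integers `n ≥ 2` such that every residue class modulo `n` is a
sum of two squares (where zero squares are allowed). -/
theorem forall_sum_two_squares_mod_iff (n : ℕ) (hn : 2 ≤ n) :
    (∀ z : ℤ, ∃ x y : ℤ, x ^ 2 + y ^ 2 ≡ z [ZMOD (n : ℤ)]) ↔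
      ((∀ q : ℕ, q.Prime → q % 4 = 3 → ¬ q ^ 2 ∣ n) ∧ ¬ 4 ∣ n) := by
  constructor
  · refine fun h ↦ ⟨fun q hq h3 hqn ↦ ?_, fun h4 ↦ ?_⟩
    · obtain ⟨x, y, hxy⟩ := h q
      have hd : (q : ℤ) ^ 2 ∣ q - (x ^ 2 + y ^ 2) :=
        (by exact_mod_cast hqn : (q : ℤ) ^ 2 ∣ n).trans hxy.dvd
      have hs : (q : ℤ) ∣ x ^ 2 + y ^ 2 :=
        (dvd_sub_right (dvd_refl _)).1 ((dvd_pow_self _ two_ne_zero).trans hd)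
      have hx := pow_dvd_pow_of_dvd (dvd_of_dvd_sq_add_sq hq h3 hs) 2
      have hy := pow_dvd_pow_of_dvd (dvd_of_dvd_sq_add_sq hq h3 (add_comm (x ^ 2) _ ▸ hs)) 2
      have hqq : (q : ℤ) ^ 2 ∣ q := by simpa using dvd_add hd (dvd_add hx hy)
      have := Nat.le_of_dvd hq.pos (by exact_mod_cast hqq : q ^ 2 ∣ q)
      nlinarith [hq.two_le]
    · obtain ⟨x, y, hxy⟩ := h 3
      have h4' : x ^ 2 + y ^ 2 ≡ 3 [ZMOD 4] := hxy.of_dvd (by exact_mod_cast h4)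
      have hsq (w : ℤ) : w ^ 2 % 4 = 0 ∨ w ^ 2 % 4 = 1 := by
        rcases Int.even_or_odd' w with ⟨c, rfl | rfl⟩ <;> ring_nf <;> omega
      have := hsq x
      have := hsq y
      unfold Int.ModEq at h4'
      omega
  · rintro ⟨hq, h4⟩
    clear hn
    induction n using Nat.recOnPosPrimePosCoprime with
    | zero => simp at h4
    | one => exact fun z ↦ ⟨0, 0, by simpa using Int.modEq_one⟩
    | prime_pow p k hp hk =>
      have := Fact.mk hp
      intro z
      rcases Nat.lt_or_ge k 2 with hk2 | hk2
      · obtain rfl : k = 1 := by omega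
        obtain ⟨a, b, -, -, hab⟩ := Nat.sq_add_sq_zmodEq p z
        exact ⟨a, b, by simpa using hab⟩
      · have h2 : p ^ 2 ∣ p ^ k := pow_dvd_pow p hk2
        have hodd : p % 2 = 1 := hp.eq_two_or_odd.resolve_left (by rintro rfl; exact h4 h2)
        have h3 : p % 4 ≠ 3 := fun h ↦ hq p hp h h2
        obtain ⟨i, hi⟩ := exists_pow_dvd_sq_add_one hp (by omega) (k - 1)
        rw [Nat.sub_add_cancel hk] at hi
        refine exists_sq_add_sq_modEq_of_dvd_sq_add_one ?_ (by exact_mod_cast hi) z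
        exact_mod_cast Nat.odd_iff.1 ((Nat.odd_iff.2 hodd).pow)
    | coprime a b ha hb hab iha ihb =>
      exact fun z ↦ exists_sq_add_sq_modEq_mul hab
        (iha (fun q h h' hd ↦ hq q h h' (hd.mul_right b)) (fun hd ↦ h4 (hd.mul_right b)) z)
        (ihb (fun q h h' hd ↦ hq q h h' (hd.mul_left a)) (fun hd ↦ h4 (hd.mul_left a)) z)
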